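/- (Lebesgue differentiation with off-center balls) Let μ be a locally finite Borel measure on ℝ^d and f ∈ L¹_loc(μ). Then for μ-almost every x, the averages (1/μ(B)) ∫_B f dμ converge to f(x) along any sequence of balls B with x ∈ (1/2)B (the ball with same center and half the radius) and radius tending to 0. -/

import Mathlib

open MeasureTheory Metric Set Filter
open scoped ENNReal NNReal Topology

noncomputable section

section BallCovering

variable {E ι : Type*} [NormedAddCommGroup E]

/-- Greedy selection: from a finite family of balls whose half-balls cover `K`, one can extract
a subfamily covering `K`, with marked points in the half-balls such that for any two of the
balls, the marked point of one with smaller radius is not in the other. -/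
lemma exists_subfamily_notMem_ball (s : Finset ι) (c : ι → E) (r : ι → ℝ) (K : Set E)
    (hK : K ⊆ ⋃ i ∈ s, ball (c i) (r i / 2)) :
    ∃ u ⊆ s, ∃ x : ι → E, (∀ i ∈ u, x i ∈ ball (c i) (r i / 2)) ∧
      K ⊆ ⋃ i ∈ u, ball (c i) (r i) ∧
      ∀ i ∈ u, ∀ j ∈ u, i ≠ j →
        (r j ≤ r i ∧ x j ∉ ball (c i) (r i)) ∨ (r i ≤ r j ∧ x i ∉ ball (c j) (r j)) := by
  classical
  induction s using Finset.induction_on_min_value r generalizing K with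
  | empty => exact ⟨∅, subset_rfl, c, by simp, by simpa using hK, by simp⟩
  | insert a s has hmin ih =>
    obtain ⟨u, hus, x, hx, hcov, hsep⟩ := ih (K ∩ ⋃ i ∈ s, ball (c i) (r i / 2)) inter_subset_right
    by_cases hsub : K ∩ ball (c a) (r a / 2) ⊆ ⋃ i ∈ u, ball (c i) (r i)
    · refine ⟨u, hus.trans (Finset.subset_insert _ _), x, hx, fun y hy ↦ ?_, hsep⟩
      have := hK hy
      rw [Finset.set_biUnion_insert] at this
      rcases this with h | h
      exacts [hsub ⟨hy, h⟩, hcov ⟨hy, h⟩]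
    · obtain ⟨p, ⟨hpK, hp⟩, hpu⟩ := not_subset.1 hsub
      have hau : a ∉ u := fun h ↦ has (hus h)
      have hne {i : ι} (hi : i ∈ u) : i ≠ a := fun h ↦ hau (h ▸ hi)
      have hpu' {i : ι} (hi : i ∈ u) : p ∉ ball (c i) (r i) := fun h ↦ hpu (mem_biUnion hi h)
      refine ⟨insert a u, Finset.insert_subset_insert _ hus, Function.update x a p, ?_, ?_, ?_⟩
      · intro i hi
        rcases Finset.mem_insert.1 hi with rfl | hi
        · simpa using hp
        · simpa [hne hi] using hx i hi
      · intro y hy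
        have := hK hy
        rw [Finset.set_biUnion_insert] at this ⊢
        rcases this with h | h
        · rw [mem_ball] at h
          have : 0 ≤ dist y (c a) := dist_nonneg
          exact Or.inl (mem_ball.2 (by linarith))
        · exact Or.inr (hcov ⟨hy, h⟩)
      · intro i hi j hj hij
        rcases Finset.mem_insert.1 hi with rfl | hiu <;>
          rcases Finset.mem_insert.1 hj with rfl | hju
        · exact absurd rfl hij
        · right
          rw [Function.update_self]
          exact ⟨hmin j (hus hju), hpu' hju⟩
        · left
          rw [Function.update_self]
          exact ⟨hmin i (hus hiu), hpu' hiu⟩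
        · simpa [hne hiu, hne hju] using hsep i hiu j hju hij

variable [NormedSpace ℝ E]

/-- If `z` lies in a ball, `x` in the concentric half-ball, `y` outside of the ball, and `x` and `y`
are seen from `z` in nearby directions, then `y` is much further away from `z` than `x`. -/
lemma norm_sub_add_le_of_notMem_ball {c x y z : E} {r : ℝ} (hz : z ∈ ball c r)
    (hx : x ∈ ball c (r / 2)) (hy : y ∉ ball c r)
    (hxy : ‖‖y - z‖⁻¹ • (y - z) - ‖x - z‖⁻¹ • (x - z)‖ ≤ 1 / 6) :
    ‖x - z‖ + r / 4 ≤ ‖y - z‖ := by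
  by_contra! h
  apply hy
  rw [mem_ball, dist_eq_norm] at *
  have hr : 0 < r := (norm_nonneg _).trans_lt hz
  have hxz : ‖x - z‖ < 3 / 2 * r := by
    have := norm_sub_le (x - c) (z - c)
    rw [sub_sub_sub_cancel_right] at this
    linarith
  have eq_norm_smul (a : E) : ‖a‖ • ‖a‖⁻¹ • a = a := by
    rcases eq_or_ne a 0 with rfl | ha
    · simp
    · rw [smul_smul, mul_inv_cancel₀ (norm_ne_zero_iff.2 ha), one_smul]
  set a := x - z with ha
  set b := y - z with hb
  clear_value a b
  rcases le_total ‖b‖ ‖a‖ with hab | hab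
  · rcases eq_or_ne a 0 with ha0 | ha0
    · have hb0 : b = 0 := by simpa [ha0] using hab
      rwa [sub_eq_zero.1 (hb.symm.trans hb0)]
    have ha_pos : 0 < ‖a‖ := norm_pos_iff.2 ha0
    obtain ⟨t, ht⟩ : ∃ t, t = ‖b‖ / ‖a‖ := ⟨_, rfl⟩
    have ht0 : 0 ≤ t := ht ▸ by positivity
    have ht1 : t ≤ 1 := ht ▸ (div_le_one ha_pos).2 hab
    have hta : t * ‖a‖ = ‖b‖ := by rw [ht, div_mul_cancel₀ _ ha_pos.ne']
    have hba : b - t • a = ‖b‖ • (‖b‖⁻¹ • b - ‖a‖⁻¹ • a) := by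
      rw [smul_sub, eq_norm_smul, smul_smul, ht, div_eq_mul_inv]
    have hnorm : ‖b - t • a‖ ≤ t * (r / 4) := by
      calc ‖b - t • a‖ ≤ ‖b‖ * (1 / 6) := by
            rw [hba, norm_smul, norm_norm]
            gcongr
        _ = t * (‖a‖ * (1 / 6)) := by rw [← hta]; ring
        _ ≤ t * (r / 4) := mul_le_mul_of_nonneg_left (by linarith) ht0
    have hdecomp : y - c = ((1 - t) • (z - c) + t • (x - c)) + (b - t • a) := by
      rw [ha, hb]; module
    have h1 : ‖y - c‖ ≤ (1 - t) * ‖z - c‖ + t * ‖x - c‖ + t * (r / 4) := by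
      rw [hdecomp]
      refine (norm_add_le _ _).trans (add_le_add ((norm_add_le _ _).trans ?_) hnorm)
      rw [norm_smul, norm_smul, Real.norm_of_nonneg ht0, Real.norm_of_nonneg (sub_nonneg.2 ht1)]
    rcases ht0.eq_or_lt with rfl | ht_pos
    · linarith
    · nlinarith [mul_le_mul_of_nonneg_left hz.le (sub_nonneg.2 ht1),
        mul_le_mul_of_nonneg_left hx.le ht0, mul_pos ht_pos hr]
  · have hba : b - a = (‖b‖ - ‖a‖) • ‖b‖⁻¹ • b + ‖a‖ • (‖b‖⁻¹ • b - ‖a‖⁻¹ • a) := by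
      rw [smul_sub, sub_smul, eq_norm_smul, eq_norm_smul]; abel
    have hunit : ‖‖b‖⁻¹ • b‖ ≤ 1 := by
      rw [norm_smul, norm_inv, norm_norm]
      exact inv_mul_le_one
    have h1 : ‖b - a‖ ≤ (‖b‖ - ‖a‖) * 1 + ‖a‖ * (1 / 6) := by
      rw [hba]
      refine (norm_add_le _ _).trans ?_
      rw [norm_smul, norm_smul ‖a‖, norm_norm, Real.norm_of_nonneg (sub_nonneg.2 hab)]
      gcongr
    have h2 : y - c = (b - a) + (x - c) := by rw [ha, hb]; abel
    rw [h2]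
    linarith [norm_add_le (b - a) (x - c)]

variable (E) in
/-- A family of balls as in `exists_subfamily_notMem_ball` has bounded overlap. -/
lemma exists_card_filter_mem_ball_le [FiniteDimensional ℝ E] [DecidableEq ι] :
    ∃ N : ℕ, ∀ (u : Finset ι) (c x : ι → E) (r : ι → ℝ),
      (∀ i ∈ u, x i ∈ ball (c i) (r i / 2)) →
      (∀ i ∈ u, ∀ j ∈ u, i ≠ j →
        (r j ≤ r i ∧ x j ∉ ball (c i) (r i)) ∨ (r i ≤ r j ∧ x i ∉ ball (c j) (r j))) →
      ∀ v ⊆ u, ∀ z, (∀ i ∈ v, z ∈ ball (c i) (r i)) → v.card ≤ N := by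
  classical
  have : ProperSpace E := FiniteDimensional.proper ℝ E
  obtain ⟨T, -, hTfin, hT⟩ := (isCompact_closedBall (0 : E) 1).finite_cover_balls
    (show (0 : ℝ) < 1 / 12 by norm_num)
  lift T to Finset E using hTfin
  refine ⟨7 * T.card, fun u c x r hx hsep v hvu z hz ↦ ?_⟩
  have hdir (i : ι) : ∃ p ∈ T, ‖x i - z‖⁻¹ • (x i - z) ∈ ball p (1 / 12) := by
    have : ‖x i - z‖⁻¹ • (x i - z) ∈ closedBall (0 : E) 1 := by
      rw [mem_closedBall_zero_iff, norm_smul, norm_inv, norm_norm]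
      exact inv_mul_le_one
    simpa using hT this
  choose φ hφT hφ using hdir
  refine Finset.card_le_mul_card_image_of_maps_to (f := φ) (fun i _ ↦ hφT i) 7 fun p _ ↦ ?_
  set w := v.filter (φ · = p) with hw
  rcases w.eq_empty_or_nonempty with hwe | hwne
  · simp [hwe]
  have hwv {i : ι} (hi : i ∈ w) : i ∈ v := (Finset.mem_filter.1 hi).1
  have hdirw {i j : ι} (hi : i ∈ w) (hj : j ∈ w) :
      ‖‖x j - z‖⁻¹ • (x j - z) - ‖x i - z‖⁻¹ • (x i - z)‖ ≤ 1 / 6 := by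
    have h1 := mem_ball.1 (hφ i)
    have h2 := mem_ball.1 (hφ j)
    rw [(Finset.mem_filter.1 hi).2] at h1
    rw [(Finset.mem_filter.1 hj).2] at h2
    rw [← dist_eq_norm]
    linarith [dist_triangle_right (‖x j - z‖⁻¹ • (x j - z)) (‖x i - z‖⁻¹ • (x i - z)) p]
  have hsepw {i j : ι} (hi : i ∈ w) (hj : j ∈ w) (hij : i ≠ j) :
      (r j ≤ r i ∧ ‖x i - z‖ + r i / 4 ≤ ‖x j - z‖) ∨
        (r i ≤ r j ∧ ‖x j - z‖ + r j / 4 ≤ ‖x i - z‖) :=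
    (hsep i (hvu (hwv hi)) j (hvu (hwv hj)) hij).imp
      (fun h ↦ ⟨h.1, norm_sub_add_le_of_notMem_ball (hz i (hwv hi)) (hx i (hvu (hwv hi))) h.2
        (hdirw hi hj)⟩)
      (fun h ↦ ⟨h.1, norm_sub_add_le_of_notMem_ball (hz j (hwv hj)) (hx j (hvu (hwv hj))) h.2
        (hdirw hj hi)⟩)
  have hrpos {i : ι} (hi : i ∈ w) : 0 < r i := dist_nonneg.trans_lt (mem_ball.1 (hz i (hwv hi)))
  obtain ⟨m, hm, hmax⟩ := w.exists_max_image (fun i ↦ ‖x i - z‖) hwne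
  have hmpos := hrpos hm
  have hrm {i : ι} (hi : i ∈ w) : r m ≤ r i := by
    rcases eq_or_ne i m with rfl | him
    · exact le_rfl
    rcases hsepw hi hm him with h | h
    · exact h.1
    · linarith [hmax i hi]
  have hym : ‖x m - z‖ < 3 / 2 * r m := by
    have h1 := mem_ball.1 (hx m (hvu (hwv hm)))
    have h2 := mem_ball.1 (hz m (hwv hm))
    rw [← dist_eq_norm]
    linarith [dist_triangle_right (x m) z (c m)]
  have hmaps : ∀ i ∈ w, ⌊‖x i - z‖ / (r m / 4)⌋₊ ∈ Finset.range 7 := by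
    intro i hi
    rw [Finset.mem_range, Nat.floor_lt (by positivity), div_lt_iff₀ (by positivity)]
    have := hmax i hi
    push_cast
    linarith
  have hinj : Set.InjOn (fun i ↦ ⌊‖x i - z‖ / (r m / 4)⌋₊) w := by
    have key {i j : ι} (hi : i ∈ w) (h : ‖x i - z‖ + r i / 4 ≤ ‖x j - z‖) :
        ⌊‖x i - z‖ / (r m / 4)⌋₊ < ⌊‖x j - z‖ / (r m / 4)⌋₊ := by
      rw [← Nat.add_one_le_iff, ← Nat.floor_add_one (by positivity)]
      apply Nat.floor_mono
      rw [← div_self (show r m / 4 ≠ 0 by positivity), ← add_div]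
      have := hrm hi
      gcongr
      linarith
    intro i hi j hj hij
    by_contra hne
    rcases hsepw hi hj hne with h | h
    · exact (key hi h.2).ne hij
    · exact (key hj h.2).ne' hij
  simpa using Finset.card_le_card_of_injOn _ hmaps hinj

end BallCovering

section Differentiation

lemma Continuous.exists_setLIntegral_halfBall_enorm_sub_le {X F : Type*} [PseudoMetricSpace X]
    [MeasurableSpace X] {μ : Measure X} [NormedAddCommGroup F] {h : X → F} (hh : Continuous h) (x : X) {η : ℝ≥0∞} (hη : 0 < η) :
    ∃ R > (0 : ℝ), ∀ c r, x ∈ ball c (r / 2) → r < R →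
      ∫⁻ y in ball c r, ‖h y - h x‖ₑ ∂μ ≤ η * μ (ball c r) := by
  have hcont : Tendsto (fun y ↦ ‖h y - h x‖ₑ) (𝓝 x) (𝓝 0) := by
    have : Continuous fun y ↦ ‖h y - h x‖ₑ := by fun_prop
    simpa using this.tendsto x
  obtain ⟨δ, hδ, hball⟩ := Metric.eventually_nhds_iff.1 (hcont.eventually (gt_mem_nhds hη))
  refine ⟨δ / 2, half_pos hδ, fun c r hx hr ↦ ?_⟩
  rw [← setLIntegral_const]
  refine setLIntegral_mono measurable_const fun y hy ↦ (hball ?_).le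
  rw [mem_ball] at hx hy
  have := dist_nonneg (x := x) (y := c)
  linarith [dist_triangle_right y x c]

variable {E : Type*} [NormedAddCommGroup E] [NormedSpace ℝ E] [FiniteDimensional ℝ E]
  [MeasurableSpace E] [BorelSpace E]

variable (E) in
/-- Weak type (1,1) bound for the maximal operator over balls containing the point in the
concentric half-ball. -/
lemma exists_mul_measure_halfBall_maximal_le :
    ∃ N : ℕ, ∀ (μ : Measure E) [IsLocallyFiniteMeasure μ] (g : E → ℝ≥0∞), AEMeasurable g μ → ∀ t : ℝ≥0∞,
      t * μ {x | ∃ c r, x ∈ ball c (r / 2) ∧ t * μ (ball c r) ≤ ∫⁻ y in ball c r, g y ∂μ} ≤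
        N * ∫⁻ y, g y ∂μ := by
  classical
  have : ProperSpace E := FiniteDimensional.proper ℝ E
  obtain ⟨N, hN⟩ := exists_card_filter_mem_ball_le (ι := E × ℝ) E
  refine ⟨N, fun μ _ g hg t ↦ ?_⟩
  set S : Set (E × ℝ) :=
    {p | t * μ (ball p.1 p.2) ≤ ∫⁻ y in ball p.1 p.2, g y ∂μ} with hS
  have hU : {x | ∃ c r, x ∈ ball c (r / 2) ∧ t * μ (ball c r) ≤ ∫⁻ y in ball c r, g y ∂μ} =
      ⋃ p ∈ S, ball p.1 (p.2 / 2) := by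
    ext x; simp [hS, and_comm]
  have hopen : IsOpen (⋃ p ∈ S, ball p.1 (p.2 / 2)) := isOpen_biUnion fun _ _ ↦ isOpen_ball
  rw [hU, hopen.measure_eq_iSup_isCompact]
  simp only [ENNReal.mul_iSup, iSup_le_iff]
  intro K hKU hK
  obtain ⟨b, hbS, hbfin, hb⟩ := hK.elim_finite_subcover_image (fun _ _ ↦ isOpen_ball) hKU
  lift b to Finset (E × ℝ) using hbfin
  obtain ⟨u, hub, x, hx, hcov, hsep⟩ :=
    exists_subfamily_notMem_ball b (fun p ↦ p.1) (fun p ↦ p.2) K (by simpa using hb)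
  calc t * μ K ≤ t * ∑ p ∈ u, μ (ball p.1 p.2) := by
        gcongr
        exact (measure_mono hcov).trans (measure_biUnion_finset_le _ _)
    _ ≤ ∑ p ∈ u, ∫⁻ y in ball p.1 p.2, g y ∂μ := by
        rw [Finset.mul_sum]
        exact Finset.sum_le_sum fun p hp ↦ hbS (hub hp)
    _ = ∫⁻ y, ∑ p ∈ u, (ball p.1 p.2).indicator g y ∂μ := by
        rw [lintegral_finsetSum' _ fun p _ ↦ hg.indicator measurableSet_ball]
        simp only [lintegral_indicator measurableSet_ball]
    _ ≤ ∫⁻ y, N * g y ∂μ := by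
        refine lintegral_mono fun z ↦ ?_
        simp only [indicator_apply]
        rw [← Finset.sum_filter, Finset.sum_const, nsmul_eq_mul]
        gcongr
        exact hN u _ x _ hx hsep _ (Finset.filter_subset _ _) z
          fun p hp ↦ (Finset.mem_filter.1 hp).2
    _ = N * ∫⁻ y, g y ∂μ := lintegral_const_mul' _ _ (ENNReal.natCast_ne_top N)

variable {μ : Measure E} [IsLocallyFiniteMeasure μ] {F : Type*} [NormedAddCommGroup F]

lemma MeasureTheory.Integrable.ae_exists_setLIntegral_halfBall_enorm_sub_le [NormedSpace ℝ F] {f : E → F}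
    (hf : Integrable f μ) {η : ℝ≥0∞} (hη : 0 < η) (hη' : η ≠ ∞) :
    ∀ᵐ x ∂μ, ∃ R > (0 : ℝ), ∀ c r, x ∈ ball c (r / 2) → r < R →
      ∫⁻ y in ball c r, ‖f y - f x‖ₑ ∂μ ≤ η * μ (ball c r) := by
  have : ProperSpace E := FiniteDimensional.proper ℝ E
  obtain ⟨N, hN⟩ := exists_mul_measure_halfBall_maximal_le E
  have hη3 : 0 < η / 3 := ENNReal.div_pos hη.ne' (by simp)
  have hη3' : η / 3 ≠ ∞ := ENNReal.div_ne_top hη' (by simp)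
  have hsum : η / 3 + η / 3 + η / 3 = η := ENNReal.add_thirds η
  rw [ae_iff]
  set A := {x | ¬ ∃ R > (0 : ℝ), ∀ c r, x ∈ ball c (r / 2) → r < R →
    ∫⁻ y in ball c r, ‖f y - f x‖ₑ ∂μ ≤ η * μ (ball c r)} with hA
  have hle (ε : ℝ≥0∞) (hε : ε ≠ 0) : η / 3 * μ A ≤ (N + 1) * ε := by
    obtain ⟨h, -, hint, hcont, -⟩ := hf.exists_hasCompactSupport_lintegral_sub_le hε
    have hmeas : AEMeasurable (fun y ↦ ‖f y - h y‖ₑ) μ :=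
      (hf.1.sub hcont.aestronglyMeasurable).enorm
    have hsub : A ⊆ {x | ∃ c r, x ∈ ball c (r / 2) ∧
        η / 3 * μ (ball c r) ≤ ∫⁻ y in ball c r, ‖f y - h y‖ₑ ∂μ} ∪
        {x | η / 3 ≤ ‖f x - h x‖ₑ} := by
      intro x hxA
      by_contra hx
      simp only [mem_union, mem_ofPred, not_or, not_exists, not_and, not_le] at hx
      obtain ⟨hx1, hx2⟩ := hx
      obtain ⟨R, hR, hRle⟩ := hcont.exists_setLIntegral_halfBall_enorm_sub_le (μ := μ) x hη3
      refine hxA ⟨R, hR, fun c r hxc hr ↦ ?_⟩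
      calc ∫⁻ y in ball c r, ‖f y - f x‖ₑ ∂μ
          ≤ ∫⁻ y in ball c r, (‖f y - h y‖ₑ + (‖h y - h x‖ₑ + ‖f x - h x‖ₑ)) ∂μ := by
            refine lintegral_mono fun y ↦ ?_
            have : f y - f x = (f y - h y) + ((h y - h x) - (f x - h x)) := by abel
            rw [this]
            exact (enorm_add_le _ _).trans (add_le_add_right enorm_sub_le _)
        _ = ∫⁻ y in ball c r, ‖f y - h y‖ₑ ∂μ + (∫⁻ y in ball c r, ‖h y - h x‖ₑ ∂μ +
              ‖f x - h x‖ₑ * μ (ball c r)) := by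
            rw [lintegral_add_left' hmeas.restrict, lintegral_add_right _ measurable_const,
              setLIntegral_const]
        _ ≤ η / 3 * μ (ball c r) + (η / 3 * μ (ball c r) + η / 3 * μ (ball c r)) := by
            gcongr
            exacts [(hx1 c r hxc).le, hRle c r hxc hr]
        _ = η * μ (ball c r) := by rw [← add_mul, ← add_mul, ← add_assoc, hsum]
    calc η / 3 * μ A ≤ η / 3 * μ {x | ∃ c r, x ∈ ball c (r / 2) ∧
            η / 3 * μ (ball c r) ≤ ∫⁻ y in ball c r, ‖f y - h y‖ₑ ∂μ} +
          η / 3 * μ {x | η / 3 ≤ ‖f x - h x‖ₑ} := by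
          rw [← mul_add]
          gcongr
          exact (measure_mono hsub).trans (measure_union_le _ _)
      _ ≤ N * ∫⁻ y, ‖f y - h y‖ₑ ∂μ + ∫⁻ y, ‖f y - h y‖ₑ ∂μ :=
          add_le_add (hN μ _ hmeas _) (mul_meas_ge_le_lintegral₀ hmeas _)
      _ ≤ (N + 1) * ε := by
          rw [add_mul, one_mul]
          gcongr
  have hlim : Tendsto (fun ε : ℝ≥0∞ ↦ (N + 1) * ε) (𝓝[>] 0) (𝓝 0) := by
    have : Tendsto (fun ε : ℝ≥0∞ ↦ (N + 1) * ε) (𝓝 0) (𝓝 ((N + 1) * 0)) :=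
      ENNReal.Tendsto.const_mul tendsto_id (Or.inr (by finiteness))
    rw [mul_zero] at this
    exact this.mono_left nhdsWithin_le_nhds
  have hzero : η / 3 * μ A ≤ 0 :=
    ge_of_tendsto hlim (eventually_nhdsWithin_of_forall fun ε hε ↦ hle ε (ne_of_gt hε))
  exact (mul_eq_zero.1 (le_antisymm hzero bot_le)).resolve_left hη3.ne'

lemma MeasureTheory.LocallyIntegrable.ae_exists_setLIntegral_halfBall_enorm_sub_le [NormedSpace ℝ F]
    {f : E → F} (hf : LocallyIntegrable f μ) {η : ℝ≥0∞} (hη : 0 < η) (hη' : η ≠ ∞) :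
    ∀ᵐ x ∂μ, ∃ R > (0 : ℝ), ∀ c r, x ∈ ball c (r / 2) → r < R →
      ∫⁻ y in ball c r, ‖f y - f x‖ₑ ∂μ ≤ η * μ (ball c r) := by
  have : ProperSpace E := FiniteDimensional.proper ℝ E
  obtain ⟨u, u_open, u_univ, hu⟩ := hf.exists_nat_integrableOn
  have hall : ∀ᵐ x ∂μ, ∀ n, ∃ R > (0 : ℝ), ∀ c r, x ∈ ball c (r / 2) → r < R →
      ∫⁻ y in ball c r, ‖(u n).indicator f y - (u n).indicator f x‖ₑ ∂μ ≤ η * μ (ball c r) :=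
    ae_all_iff.2 fun n ↦ Integrable.ae_exists_setLIntegral_halfBall_enorm_sub_le
      ((integrable_indicator_iff (u_open n).measurableSet).2 (hu n)) hη hη'
  filter_upwards [hall] with x hx
  obtain ⟨n, hn⟩ : ∃ n, x ∈ u n := by simpa [← u_univ] using mem_univ x
  obtain ⟨R, hR, hRle⟩ := hx n
  obtain ⟨δ, hδ, hball⟩ := Metric.isOpen_iff.1 (u_open n) x hn
  refine ⟨min R (δ / 2), lt_min hR (half_pos hδ), fun c r hxc hr ↦ ?_⟩
  refine le_of_eq_of_le ?_ (hRle c r hxc (hr.trans_le (min_le_left _ _)))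
  refine setLIntegral_congr_fun measurableSet_ball fun y hy ↦ ?_
  have hyu : y ∈ u n := by
    refine hball (mem_ball.2 ?_)
    have hr' := hr.trans_le (min_le_right _ _)
    rw [mem_ball] at hxc hy
    have := dist_nonneg (x := x) (y := c)
    linarith [dist_triangle_right y x c]
  simp [hn, hyu]

/-- **Lebesgue differentiation theorem** for balls containing the point in the concentric
half-ball. -/
lemma MeasureTheory.LocallyIntegrable.ae_tendsto_average_halfBall [NormedSpace ℝ F] [CompleteSpace F]
    {f : E → F} (hf : LocallyIntegrable f μ) :
    ∀ᵐ x ∂μ, ∀ (c : ℕ → E) (ρ : ℕ → ℝ), (∀ n, x ∈ ball (c n) (ρ n / 2)) →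
      (∀ n, μ (ball (c n) (ρ n)) ≠ 0) → Tendsto ρ atTop (𝓝 0) →
      Tendsto (fun n ↦ ⨍ y in ball (c n) (ρ n), f y ∂μ) atTop (𝓝 (f x)) := by
  have : ProperSpace E := FiniteDimensional.proper ℝ E
  have hall : ∀ᵐ x ∂μ, ∀ k : ℕ, ∃ R > (0 : ℝ), ∀ c r, x ∈ ball c (r / 2) → r < R →
      ∫⁻ y in ball c r, ‖f y - f x‖ₑ ∂μ ≤ ((k : ℝ≥0∞) + 1)⁻¹ * μ (ball c r) :=
    ae_all_iff.2 fun k ↦ LocallyIntegrable.ae_exists_setLIntegral_halfBall_enorm_sub_le hf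
      (ENNReal.inv_pos.2 (by finiteness)) (ENNReal.inv_ne_top.2 (by simp))
  filter_upwards [hall] with x hx c ρ hxc hμ hρ
  rw [tendsto_iff_edist_tendsto_0, ENNReal.tendsto_nhds_zero]
  intro ε hε
  obtain ⟨k, hk⟩ := ENNReal.exists_inv_nat_lt hε.ne'
  obtain ⟨R, hR, hRle⟩ := hx k
  filter_upwards [hρ.eventually (gt_mem_nhds hR)] with n hn
  set B := ball (c n) (ρ n) with hB
  have hBtop : μ B ≠ ∞ := measure_ball_lt_top.ne
  have hfB : IntegrableOn f B μ :=
    (hf.integrableOn_isCompact (isCompact_closedBall (c n) (ρ n))).mono_set ball_subset_closedBall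
  have hconst : IntegrableOn (fun _ ↦ f x) B μ := integrableOn_const hBtop
  have havg : ⨍ y in B, f y ∂μ - f x = ⨍ y in B, (f y - f x) ∂μ := by
    rw [setAverage_eq, setAverage_eq, integral_sub hfB hconst, smul_sub, ← setAverage_eq,
      ← setAverage_eq _ fun _ ↦ f x, setAverage_const (hμ n) hBtop]
  rw [edist_eq_enorm_sub, havg]
  calc ‖⨍ y in B, (f y - f x) ∂μ‖ₑ ≤ (μ B)⁻¹ * ∫⁻ y in B, ‖f y - f x‖ₑ ∂μ := by
        refine (enorm_integral_le_lintegral_enorm _).trans ?_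
        simp [lintegral_smul_measure]
    _ ≤ (μ B)⁻¹ * (((k : ℝ≥0∞) + 1)⁻¹ * μ B) := by
        gcongr
        exact hRle _ _ (hxc n) hn
    _ = ((k : ℝ≥0∞) + 1)⁻¹ := by
        rw [mul_comm, mul_assoc, ENNReal.mul_inv_cancel (hμ n) hBtop, mul_one]
    _ ≤ (k : ℝ≥0∞)⁻¹ := ENNReal.inv_le_inv.2 le_self_add
    _ ≤ ε := hk.le

end Differentiation

/-- Lebesgue differentiation with off-center balls: for a locally finite Borel
measure `μ` and `f ∈ L¹_loc(μ)`, for `μ`-a.e. `x`, the averages of `f` over any sequence of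
balls `B` containing `x` in the concentric half-ball, with radii tending to `0` and
`μ(B) ≠ 0`, converge to `f(x)`. -/
theorem statement13 (d : ℕ) (μ : Measure (EuclideanSpace ℝ (Fin d)))
    [IsLocallyFiniteMeasure μ] (f : EuclideanSpace ℝ (Fin d) → ℝ)
    (hf : LocallyIntegrable f μ) :
    ∀ᵐ x ∂μ, ∀ (c : ℕ → EuclideanSpace ℝ (Fin d)) (ρ : ℕ → ℝ),
      (∀ n, 0 < ρ n) → (∀ n, x ∈ ball (c n) (ρ n / 2)) →
      (∀ n, μ (ball (c n) (ρ n)) ≠ 0) →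
      Tendsto ρ atTop (𝓝 0) →
      Tendsto (fun n => ⨍ y in ball (c n) (ρ n), f y ∂μ) atTop (𝓝 (f x)) := by
  filter_upwards [LocallyIntegrable.ae_tendsto_average_halfBall hf] with x hx c ρ _ hxc hμ hρ
  exact hx c ρ hxc hμ hρ
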